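/- Let 0 < ε < π/2 and 0 < η < min{π/4, ε/2}, μ₊, μ₋, ρ₊, ρ₋ > 0. For λ ∈ Σ_ε and ξ' ∈ (Σ̃_η)^{n−1} set A = sqrt(Σξ_j²), Ã = sqrt(Σ|ξ_j|²), B_± = sqrt(ρ_± μ_±^{−1}λ + A²), and let det L be the Lopatinskii determinant (μ₊−μ₋)²A³ − {(3μ₊−μ₋)μ₊B₊ + (3μ₋−μ₊)μ₋B₋}A² − {(μ₊B₊+μ₋B₋)² + μ₊μ₋(B₊+B₋)²}A − (μ₊B₊+μ₋B₋)(μ₊B₊²+μ₋B₋²). Then there exists c > 0 independent of λ, ξ' such that c(|λ|^{1/2} + Ã)³ ≤ |det L|. -/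

import Mathlib

open Real

lemma st_field_id (V Vc W Wc x xc : ℂ) (h : x + xc ≠ 0) :
    (x+1)*(V*Vc) + x*(x+1)*(W*Wc) - (x-1)*(V*Wc+Vc*W)
      = ((V+W)*(Vc+Wc) + (V-W)*(Vc-Wc)*(x*xc+1)/(x+xc))
        + (x^2-1)*(W*Wc + (V-W)*(Vc-Wc)/(x+xc)) := by
  field_simp
  ring

noncomputable def stE1 (x V W : ℂ) : ℝ := ‖V+W‖^2 + ‖V-W‖^2*(‖x‖^2+1)/(2*x.re)
noncomputable def stE2 (x V W : ℂ) : ℝ := ‖W‖^2 + ‖V-W‖^2/(2*x.re)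

lemma st_energy (V W x : ℂ) (hx : 0 < x.re) :
    (x+1)*(V*(starRingEnd ℂ) V) + x*(x+1)*(W*(starRingEnd ℂ) W)
      - (x-1)*(V*(starRingEnd ℂ) W+(starRingEnd ℂ) V*W)
      = (stE1 x V W : ℂ) + (x^2-1)*(stE2 x V W : ℂ) := by
  have h2 : x + (starRingEnd ℂ) x = ((2*x.re : ℝ) : ℂ) := Complex.add_conj x
  have h : x + (starRingEnd ℂ) x ≠ 0 := by
    rw [h2]; exact_mod_cast (by positivity : (2*x.re) ≠ 0)
  rw [st_field_id _ _ _ _ x _ h, h2]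
  simp only [stE1, stE2]
  push_cast
  simp only [← Complex.mul_conj', map_add, map_sub]

lemma st_E1_lower (x V W : ℂ) (hx : 0 < x.re) : 2*(‖V‖^2+‖W‖^2) ≤ stE1 x V W := by
  have h1 : ‖V+W‖^2 + ‖V-W‖^2 = 2*(‖V‖^2+‖W‖^2) := by
    have := parallelogram_law_with_norm ℝ V W
    nlinarith
  have h2 : ‖V-W‖^2 ≤ ‖V-W‖^2*(‖x‖^2+1)/(2*x.re) := by
    rw [le_div_iff₀ (by positivity)]
    have h3 : x.re ≤ ‖x‖ := Complex.re_le_norm x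
    have : 2*x.re ≤ ‖x‖^2+1 := by nlinarith [sq_nonneg (‖x‖-1)]
    gcongr
  unfold stE1; linarith

lemma st_E2_lower (x V W : ℂ) (hx : 0 < x.re) : ‖W‖^2 ≤ stE2 x V W := by
  have : 0 ≤ ‖V-W‖^2/(2*x.re) := by positivity
  unfold stE2; linarith

lemma st_E2_lower' (x V W : ℂ) (hx : 0 < x.re) (K : ℝ) (hK : 1 ≤ K) (hxK : 2*x.re ≤ K) :
    ‖V‖^2/(2*K) ≤ stE2 x V W := by
  have h1 : ‖V-W‖^2/K ≤ ‖V-W‖^2/(2*x.re) := by gcongr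
  have h2 : ‖W‖^2/K ≤ ‖W‖^2 := div_le_self (by positivity) hK
  have h3 : ‖V‖ ≤ ‖V-W‖ + ‖W‖ := by simpa using norm_add_le (V-W) W
  have h4 : ‖V‖^2 ≤ 2*(‖V-W‖^2+‖W‖^2) := by
    nlinarith [sq_nonneg (‖V-W‖-‖W‖), norm_nonneg V, norm_nonneg W, norm_nonneg (V-W)]
  have h5 : ‖V‖^2/(2*K) ≤ ‖V-W‖^2/K + ‖W‖^2/K := by
    rw [← add_div, div_le_div_iff₀ (by positivity) (by positivity)]
    nlinarith
  unfold stE2; linarith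

lemma st_sector (z : ℂ) (k : ℝ) (hk0 : 0 ≤ k) (hk : k < 1) (hz : -k*‖z‖ ≤ z.re) (a b : ℝ)
    (ha : 0 ≤ a) (hb : 0 ≤ b) :
    √((1-k)/2)*(a + ‖z‖*b) ≤ ‖(a:ℂ) + z*b‖ := by
  apply le_of_sq_le_sq _ (norm_nonneg _)
  rw [mul_pow, Real.sq_sqrt (by linarith)]
  have h1 : ‖(a:ℂ) + z*b‖^2 = a^2 + 2*a*b*z.re + (‖z‖*b)^2 := by
    rw [mul_pow, Complex.sq_norm, Complex.sq_norm, Complex.normSq_apply, Complex.normSq_apply]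
    simp
    ring
  rw [h1]
  have h2 : a*b*(-k*‖z‖) ≤ a*b*z.re := by gcongr
  nlinarith [mul_nonneg (by linarith : 0 ≤ 1+k) (sq_nonneg (a - ‖z‖*b))]

lemma st_det (d1 d2 o : ℂ) (a b : ℝ) (ha : 0 < a) (hb : 0 < b)
    (h1 : ∀ V W : ℂ, a*‖V‖^2 ≤ ‖d1*(V*(starRingEnd ℂ) V) + d2*(W*(starRingEnd ℂ) W)
      + o*(V*(starRingEnd ℂ) W+(starRingEnd ℂ) V*W)‖)
    (h2 : ∀ V W : ℂ, b*‖W‖^2 ≤ ‖d1*(V*(starRingEnd ℂ) V) + d2*(W*(starRingEnd ℂ) W)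
      + o*(V*(starRingEnd ℂ) W+(starRingEnd ℂ) V*W)‖) :
    a*b ≤ ‖d1*d2-o^2‖ := by
  have hd2 : b ≤ ‖d2‖ := by simpa using h2 0 1
  have h := h1 d2 (-o)
  have e : d1*(d2*(starRingEnd ℂ) d2) + d2*((-o)*(starRingEnd ℂ) (-o))
      + o*(d2*(starRingEnd ℂ) (-o)+(starRingEnd ℂ) d2*(-o)) = (d1*d2-o^2)*(starRingEnd ℂ) d2 := by
    simp only [map_neg]; ring
  rw [e, norm_mul, Complex.norm_conj] at h
  have hpos : 0 < ‖d2‖ := lt_of_lt_of_le hb hd2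
  have : a*‖d2‖ ≤ ‖d1*d2-o^2‖ := by
    apply le_of_mul_le_mul_right _ hpos
    nlinarith
  nlinarith

lemma st_main (p m ρp ρm k : ℝ) (hp : 0 < p) (hm : 0 < m) (hρp : 0 < ρp) (hρm : 0 < ρm)
    (hk0 : 0 ≤ k) (hk : k < 1) :
    ∃ c > 0, ∀ z x y : ℂ, 0 < x.re → 0 < y.re → x^2 = 1 + (ρp*p⁻¹ : ℝ)*z →
      y^2 = 1 + (ρm*m⁻¹ : ℝ)*z → -k*‖z‖ ≤ z.re →
      c*(1+√‖z‖)^3 ≤ ‖(p*(x+1)+m*(y+1))*(p*(x*(x+1))+m*(y*(y+1)))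
        - (-(p*(x-1))+m*(y-1))^2‖ := by
  set s := √((1-k)/2) with hs
  have hspos : 0 < s := Real.sqrt_pos.2 (by linarith)
  set C := 1 + √(ρp*p⁻¹) with hC
  have hC1 : 1 ≤ C := by have := Real.sqrt_nonneg (ρp*p⁻¹); linarith
  set c1 := min (2*p) ρp with hc1
  set c2 := min (2*p) (ρp/(4*C)) with hc2
  have hc1p : 0 < c1 := by positivity
  have hc2p : 0 < c2 := by positivity
  refine ⟨(s*(c2/2))*(s*(c1/2)), by positivity, ?_⟩
  intro z x y hx hy hx2 hy2 hz
  set t := √‖z‖ with ht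
  have ht0 : 0 ≤ t := Real.sqrt_nonneg _
  have ht2 : ‖z‖ = t^2 := (Real.sq_sqrt (norm_nonneg z)).symm
  have hxC : x.re ≤ C*(1+t) := by
    have h1 : ‖x‖^2 ≤ 1 + ρp*p⁻¹*t^2 := by
      rw [← norm_pow, hx2]
      refine (norm_add_le _ _).trans ?_
      rw [norm_mul, norm_one, Complex.norm_real, Real.norm_of_nonneg (by positivity), ht2]
    have h2 : ‖x‖ ≤ 1 + √(ρp*p⁻¹)*t := by
      apply le_of_sq_le_sq _ (by positivity)
      have : √(ρp*p⁻¹)^2 = ρp*p⁻¹ := Real.sq_sqrt (by positivity)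
      have h0 : 0 ≤ √(ρp*p⁻¹)*t := by positivity
      rw [← this] at h1
      nlinarith
    have h3 := Complex.re_le_norm x
    have := Real.sqrt_nonneg (ρp*p⁻¹)
    rw [hC]
    nlinarith
  have key : ∀ V W : ℂ, (p*(x+1)+m*(y+1))*(V*(starRingEnd ℂ) V)
      + (p*(x*(x+1))+m*(y*(y+1)))*(W*(starRingEnd ℂ) W)
      + (-(p*(x-1))+m*(y-1))*(V*(starRingEnd ℂ) W+(starRingEnd ℂ) V*W)
      = ((p*stE1 x V W + m*stE1 y (-V) W : ℝ) : ℂ)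
        + z*((ρp*stE2 x V W + ρm*stE2 y (-V) W : ℝ) : ℂ) := by
    intro V W
    have e1 := st_energy V W x hx
    have e2 := st_energy (-V) W y hy
    have hpc : (p:ℂ) ≠ 0 := by exact_mod_cast hp.ne'
    have hmc : (m:ℂ) ≠ 0 := by exact_mod_cast hm.ne'
    have f1 : (p:ℂ)*(x^2-1) = ρp*z := by rw [hx2]; push_cast; field_simp; ring
    have f2 : (m:ℂ)*(y^2-1) = ρm*z := by rw [hy2]; push_cast; field_simp; ring
    simp only [map_neg] at e2
    push_cast
    linear_combination (p:ℂ)*e1 + (m:ℂ)*e2 + (stE2 x V W:ℂ)*f1 + (stE2 y (-V) W:ℂ)*f2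
  have low : ∀ V W : ℂ, s*(p*stE1 x V W + t^2*(ρp*stE2 x V W)) ≤
      ‖(p*(x+1)+m*(y+1))*(V*(starRingEnd ℂ) V)
      + (p*(x*(x+1))+m*(y*(y+1)))*(W*(starRingEnd ℂ) W)
      + (-(p*(x-1))+m*(y-1))*(V*(starRingEnd ℂ) W+(starRingEnd ℂ) V*W)‖ := by
    intro V W
    have a1 : 0 ≤ stE1 x V W := le_trans (by positivity) (st_E1_lower x V W hx)
    have a2 : 0 ≤ stE1 y (-V) W := le_trans (by positivity) (st_E1_lower y (-V) W hy)
    have a3 : 0 ≤ stE2 x V W := le_trans (by positivity) (st_E2_lower x V W hx)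
    have a4 : 0 ≤ stE2 y (-V) W := le_trans (by positivity) (st_E2_lower y (-V) W hy)
    rw [key]
    refine le_trans ?_ (st_sector z k hk0 hk hz _ _ (by positivity) (by positivity))
    rw [ht2]
    have : 0 ≤ m*stE1 y (-V) W + t^2*(ρm*stE2 y (-V) W) := by positivity
    apply mul_le_mul_of_nonneg_left _ hspos.le
    linarith
  have fin := st_det (p*(x+1)+m*(y+1)) (p*(x*(x+1))+m*(y*(y+1))) (-(p*(x-1))+m*(y-1))
    (s*(c2/2)*(1+t)) (s*(c1/2)*(1+t)^2) (by positivity) (by positivity) ?_ ?_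
  · refine le_trans (le_of_eq ?_) fin
    ring
  · intro V W
    refine le_trans ?_ (low V W)
    have b1 := st_E1_lower x V W hx
    have hK : (1:ℝ) ≤ 2*(C*(1+t)) := by nlinarith
    have b2 := st_E2_lower' x V W hx (2*(C*(1+t))) hK (by linarith)
    have g1 : c2*‖V‖^2 ≤ p*stE1 x V W := by
      have : c2 ≤ 2*p := min_le_left _ _
      calc c2*‖V‖^2 ≤ 2*p*‖V‖^2 := by gcongr
        _ ≤ p*(2*(‖V‖^2+‖W‖^2)) := by nlinarith [mul_nonneg hp.le (sq_nonneg ‖W‖)]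
        _ ≤ _ := by gcongr
    have g2 : c2*(‖V‖^2/(1+t)) ≤ ρp*stE2 x V W := by
      have : c2 ≤ ρp/(4*C) := min_le_right _ _
      calc c2*(‖V‖^2/(1+t)) ≤ ρp/(4*C)*(‖V‖^2/(1+t)) := by gcongr
        _ = ρp*(‖V‖^2/(2*(2*(C*(1+t))))) := by field_simp; ring
        _ ≤ _ := by gcongr
    have g3 : c2/2*(1+t)*‖V‖^2 ≤ c2*‖V‖^2 + t^2*(c2*(‖V‖^2/(1+t))) := by
      have : c2*‖V‖^2 + t^2*(c2*(‖V‖^2/(1+t))) - c2/2*(1+t)*‖V‖^2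
        = c2*‖V‖^2*(1+t^2)/(2*(1+t)) := by field_simp; ring
      have h0 : 0 ≤ c2*‖V‖^2*(1+t^2)/(2*(1+t)) := by positivity
      linarith
    have g4 : t^2*(c2*(‖V‖^2/(1+t))) ≤ t^2*(ρp*stE2 x V W) := by gcongr
    calc s*(c2/2)*(1+t)*‖V‖^2 = s*(c2/2*(1+t)*‖V‖^2) := by ring
      _ ≤ _ := by apply mul_le_mul_of_nonneg_left _ hspos.le; linarith
  · intro V W
    refine le_trans ?_ (low V W)
    have b1 := st_E1_lower x V W hx
    have b2 := st_E2_lower x V W hx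
    have g1 : c1*‖W‖^2 ≤ p*stE1 x V W := by
      have : c1 ≤ 2*p := min_le_left _ _
      calc c1*‖W‖^2 ≤ 2*p*‖W‖^2 := by gcongr
        _ ≤ p*(2*(‖V‖^2+‖W‖^2)) := by nlinarith [mul_nonneg hp.le (sq_nonneg ‖V‖)]
        _ ≤ _ := by gcongr
    have g2 : c1*‖W‖^2 ≤ ρp*stE2 x V W := by
      have : c1 ≤ ρp := min_le_right _ _
      gcongr
    have g4 : t^2*(c1*‖W‖^2) ≤ t^2*(ρp*stE2 x V W) := by gcongr
    have g3 : c1/2*(1+t)^2*‖W‖^2 ≤ c1*‖W‖^2 + t^2*(c1*‖W‖^2) := by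
      nlinarith [mul_nonneg (mul_nonneg hc1p.le (sq_nonneg ‖W‖)) (sq_nonneg (1-t))]
    calc s*(c1/2)*(1+t)^2*‖W‖^2 = s*(c1/2*(1+t)^2*‖W‖^2) := by ring
      _ ≤ _ := by apply mul_le_mul_of_nonneg_left _ hspos.le; linarith

/-- squares of elements of the double sector -/
lemma st_sq (η : ℝ) (h0 : 0 < η) (h4 : η < π/4) (ξ : ℂ) 
    (h : |ξ.arg| < η ∨ π - η < |ξ.arg|) :
    Real.cos (2*η) * ‖ξ‖^2 ≤ (ξ^2).re ∧ |(ξ^2).im| ≤ Real.sin (2*η) * ‖ξ‖^2 := by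
  have hre : (ξ^2).re = Real.cos (2*|ξ.arg|) * ‖ξ‖^2 := by
    rw [← abs_two (α := ℝ), ← abs_mul, Real.cos_abs, Real.cos_two_mul']
    have h1 := Complex.norm_mul_cos_arg ξ
    have h2 := Complex.norm_mul_sin_arg ξ
    simp only [pow_two, Complex.mul_re]
    rw [← h1, ← h2]; ring
  have hsq : (ξ^2).re^2 + (ξ^2).im^2 = (‖ξ‖^2)^2 := by
    rw [← norm_pow, Complex.sq_norm, Complex.normSq_apply]; ring
  have hcos : Real.cos (2*η) ≤ Real.cos (2*|ξ.arg|) := by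
    rcases h with h | h
    · apply Real.cos_le_cos_of_nonneg_of_le_pi
      · positivity
      · linarith
      · linarith
    · have : Real.cos (2*|ξ.arg|) = Real.cos (2*(π-|ξ.arg|)) := by
        rw [mul_sub, Real.cos_two_pi_sub]
      rw [this]
      have := Complex.abs_arg_le_pi ξ
      apply Real.cos_le_cos_of_nonneg_of_le_pi
      · linarith
      · linarith
      · linarith
  have hcp : 0 < Real.cos (2*η) := Real.cos_pos_of_mem_Ioo ⟨by linarith, by linarith⟩
  have hsp : 0 < Real.sin (2*η) := Real.sin_pos_of_pos_of_lt_pi (by linarith) (by linarith)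
  have A : Real.cos (2*η) * ‖ξ‖^2 ≤ (ξ^2).re := by rw [hre]; gcongr
  refine ⟨A, ?_⟩
  apply abs_le_of_sq_le_sq _ (by positivity)
  have hA2 : (Real.cos (2*η) * ‖ξ‖^2)^2 ≤ (ξ^2).re^2 := by gcongr
  have := Real.sin_sq_add_cos_sq (2*η)
  nlinarith

/-- rotated sector -/
lemma st_z (ε η : ℝ) (hε2 : ε < π/2) (h0 : 0 < η) (h : 2*η < ε) (lam S : ℂ)
    (hl : |lam.arg| < π - ε) (hS : |S.arg| ≤ 2*η) :
    -Real.cos (ε-2*η)*‖lam/S‖ ≤ (lam/S).re ∧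
    (0 < lam.im → S.im < 0 → 0 ≤ (lam*(starRingEnd ℂ) S).im) ∧
    (lam.im < 0 → 0 < S.im → (lam*(starRingEnd ℂ) S).im ≤ 0) := by
  have a1 := Complex.norm_mul_cos_arg lam
  have a2 := Complex.norm_mul_sin_arg lam
  have b1 := Complex.norm_mul_cos_arg S
  have b2 := Complex.norm_mul_sin_arg S
  have him : (lam*(starRingEnd ℂ) S).im = ‖lam‖*‖S‖*Real.sin (lam.arg - S.arg) := by
    simp only [Complex.mul_im, Complex.conj_re, Complex.conj_im, Real.sin_sub]
    rw [← a1, ← a2, ← b1, ← b2]; ring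
  have hre : (lam*(starRingEnd ℂ) S).re = ‖lam‖*‖S‖*Real.cos (lam.arg - S.arg) := by
    simp only [Complex.mul_re, Complex.conj_re, Complex.conj_im, Real.cos_sub]
    rw [← a1, ← a2, ← b1, ← b2]; ring
  rw [abs_lt] at hl
  rw [abs_le] at hS
  refine ⟨?_, ?_, ?_⟩
  · have hc : -Real.cos (ε-2*η) ≤ Real.cos (lam.arg - S.arg) := by
      rw [← Real.cos_pi_sub, ← Real.cos_abs (lam.arg - S.arg)]
      apply Real.cos_le_cos_of_nonneg_of_le_pi (abs_nonneg _) (by linarith)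
      rw [abs_le]; constructor <;> linarith
    by_cases hS0 : S = 0
    · simp [hS0]
    have hSp : 0 < ‖S‖ := norm_pos_iff.2 hS0
    have : (lam/S).re = ‖lam/S‖*Real.cos (lam.arg - S.arg) := by
      have e : lam/S = ((‖S‖^2)⁻¹ : ℝ)*(lam*(starRingEnd ℂ) S) := by
        have : (starRingEnd ℂ) S ≠ 0 := by simpa using hS0
        push_cast
        rw [← Complex.mul_conj']
        field_simp
      rw [norm_div]
      conv_lhs => rw [e]
      rw [Complex.re_ofReal_mul, hre]
      field_simp
    rw [this, mul_comm]
    gcongr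
  · intro h1 h2
    rw [him]
    have c1 : 0 ≤ lam.arg := Complex.arg_nonneg_iff.2 h1.le
    have c2 : S.arg < 0 := Complex.arg_neg_iff.2 h2
    have := Real.sin_nonneg_of_nonneg_of_le_pi (x := lam.arg - S.arg) (by linarith) (by linarith)
    positivity
  · intro h1 h2
    rw [him]
    have c1 : lam.arg < 0 := Complex.arg_neg_iff.2 h1
    have c2 : 0 ≤ S.arg := Complex.arg_nonneg_iff.2 h2.le
    have := Real.sin_nonpos_of_nonpos_of_neg_pi_le (x := lam.arg - S.arg) (by linarith) (by linarith)
    have : 0 ≤ ‖lam‖*‖S‖ := by positivity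
    nlinarith

lemma st_sqrt_sq (w : ℂ) : (w ^ (1/2 : ℂ))^2 = w := by
  have := Complex.cpow_nat_inv_pow w (n := 2) (by norm_num)
  simpa using this

lemma st_sqrt_re (w : ℂ) : 0 ≤ (w ^ (1/2 : ℂ)).re := by
  by_cases hw : w = 0
  · simp [hw]
  rw [Complex.cpow_def_of_ne_zero hw, Complex.exp_re]
  have : (Complex.log w * (1/2)).im = w.arg/2 := by
    simp [Complex.mul_im, Complex.log_im]; ring
  rw [this]
  have := Complex.arg_le_pi w
  have := Complex.neg_pi_lt_arg w
  have := Real.cos_nonneg_of_mem_Icc (x := w.arg/2) ⟨by linarith, by linarith⟩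
  positivity

lemma st_root_re (a k : ℝ) (ha : 0 < a) (hk : k < 1) (lam S A B : ℂ) (hA : A^2 = S)
    (hB : B^2 = a*lam + S) (hAr : 0 < A.re) (hBr : 0 ≤ B.re)
    (hz : -k*‖lam/S‖ ≤ (lam/S).re)
    (h1 : 0 < lam.im → S.im < 0 → 0 ≤ (lam*(starRingEnd ℂ) S).im)
    (h2 : lam.im < 0 → 0 < S.im → (lam*(starRingEnd ℂ) S).im ≤ 0) :
    0 < (B/A).re ∧ (B/A)^2 = 1 + (a:ℝ)*(lam/S) := by
  have hA0 : A ≠ 0 := by rintro rfl; simp at hAr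
  have hS0 : S ≠ 0 := by rw [← hA]; exact pow_ne_zero 2 hA0
  have hsq : (B/A)^2 = 1 + (a:ℝ)*(lam/S) := by
    rw [div_pow, hA, hB]; field_simp; ring
  refine ⟨?_, hsq⟩
  have hne : (B/A).re ≠ 0 := by
    intro h0
    have e1 := congrArg Complex.re hsq
    have e2 := congrArg Complex.im hsq
    simp only [pow_two, Complex.mul_re, Complex.mul_im, h0, Complex.add_re, Complex.add_im,
      Complex.one_re, Complex.one_im, Complex.ofReal_re, Complex.ofReal_im] at e1 e2
    have e3 : (lam/S).im = 0 := by
      have : a*(lam/S).im = 0 := by linarith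
      exact (mul_eq_zero.1 this).resolve_left ha.ne'
    have e4 : (lam/S).re < 0 := by
      by_contra hh
      push Not at hh
      nlinarith [mul_nonneg ha.le hh, mul_self_nonneg (B/A).im]
    have e5 : ‖lam/S‖ = -(lam/S).re := by
      rw [← abs_of_neg e4]
      exact (Complex.abs_re_eq_norm.2 e3).symm
    rw [e5] at hz
    nlinarith
  have hP : (B/A).re = (B.re*A.re + B.im*A.im)/Complex.normSq A := by
    rw [Complex.div_re]; ring
  have hn : 0 < Complex.normSq A := Complex.normSq_pos.2 hA0
  by_contra hcon
  have hlt : (B/A).re < 0 := lt_of_le_of_ne (not_lt.1 hcon) hne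
  rw [hP, div_lt_iff₀ hn, zero_mul] at hlt
  have hSim : S.im = 2*A.re*A.im := by rw [← hA]; simp [pow_two]; ring
  have hSre : S.re = A.re^2-A.im^2 := by rw [← hA]; simp [pow_two]
  have hlim : a*lam.im = 2*B.re*B.im - 2*A.re*A.im := by
    have := congrArg Complex.im hB
    simp [pow_two] at this; linarith
  have hlre : a*lam.re = B.re^2 - B.im^2 - (A.re^2-A.im^2) := by
    have := congrArg Complex.re hB
    simp [pow_two] at this; linarith
  have hQ : a*(lam*(starRingEnd ℂ) S).im
      = 2*(B.re*A.re + B.im*A.im)*(B.im*A.re - B.re*A.im) := by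
    simp only [Complex.mul_im, Complex.conj_re, Complex.conj_im, hSim, hSre]
    linear_combination (A.re^2-A.im^2)*hlim - (2*A.re*A.im)*hlre
  have hBA : B.im*A.im < 0 := by nlinarith
  rcases lt_or_ge A.im 0 with hi | hi
  · have hb : 0 < B.im := by nlinarith
    have r1 : 0 < lam.im := by
      have : 0 < a*lam.im := by rw [hlim]; nlinarith [mul_nonneg hBr hb.le, mul_pos hAr (neg_pos.2 hi)]
      exact pos_of_mul_pos_right this ha.le
    have r2 := h1 r1 (by rw [hSim]; nlinarith)
    have : 0 < B.im*A.re - B.re*A.im := by nlinarith [mul_pos hb hAr]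
    nlinarith [mul_nonneg ha.le r2, mul_pos (neg_pos.2 hlt) this]
  · have hi' : 0 < A.im := by
      rcases hi.lt_or_eq with h | h
      · exact h
      · rw [← h] at hBA; simp at hBA
    have hb : B.im < 0 := by nlinarith
    have r1 : lam.im < 0 := by
      have : 0 < a*(-lam.im) := by
        rw [mul_neg, hlim]; nlinarith [mul_nonneg hBr (neg_pos.2 hb).le, mul_pos hAr hi']
      have := pos_of_mul_pos_right this ha.le
      linarith
    have r2 := h2 r1 (by rw [hSim]; positivity)
    have : B.im*A.re - B.re*A.im < 0 := by nlinarith [mul_pos (neg_pos.2 hb) hAr, mul_nonneg hBr hi]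
    nlinarith [mul_nonneg ha.le (neg_nonneg.2 r2), mul_pos (neg_pos.2 hlt) (neg_pos.2 this)]

lemma st_arg (θ : ℝ) (h0 : 0 < θ) (h2 : θ < π/2) (S : ℂ) (R : ℝ) (hR : 0 < R)
    (h : Real.cos θ * R ≤ S.re) (hi : |S.im| ≤ Real.sin θ * R) : |S.arg| ≤ θ := by
  have hc : 0 < Real.cos θ := Real.cos_pos_of_mem_Ioo ⟨by linarith, by linarith⟩
  have hs : 0 < Real.sin θ := Real.sin_pos_of_pos_of_lt_pi h0 (by linarith)
  have hre : 0 < S.re := lt_of_lt_of_le (by positivity) h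
  have hS0 : S ≠ 0 := by rintro rfl; simp at hre
  have hn : 0 < ‖S‖ := norm_pos_iff.2 hS0
  by_contra hcon
  push Not at hcon
  have hlt : Real.cos |S.arg| < Real.cos θ :=
    Real.cos_lt_cos_of_nonneg_of_le_pi h0.le (Complex.abs_arg_le_pi S) hcon
  rw [Real.cos_abs, Complex.cos_arg hS0, div_lt_iff₀ hn] at hlt
  have e : ‖S‖^2 = S.re^2+S.im^2 := by rw [Complex.sq_norm, Complex.normSq_apply]; ring
  have e1 : S.re^2 < (Real.cos θ*‖S‖)^2 := by gcongr
  have e2 : S.im^2 ≤ (Real.sin θ*R)^2 := by rw [← sq_abs]; gcongr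
  have e3 : (Real.cos θ*R)^2 ≤ S.re^2 := by gcongr
  have e4 := Real.sin_sq_add_cos_sq θ
  rw [mul_pow, e] at e1
  rw [mul_pow] at e2 e3
  have e5 : Real.sin θ^2*S.re^2 < Real.cos θ^2*S.im^2 := by nlinarith
  have e6 : Real.cos θ^2*S.im^2 ≤ Real.cos θ^2*(Real.sin θ^2*R^2) := by gcongr
  have e7 : Real.sin θ^2*(Real.cos θ^2*R^2) ≤ Real.sin θ^2*S.re^2 := by gcongr
  nlinarith

theorem stmt10 (n : ℕ) (hn : 2 ≤ n) (ε η μp μm ρp ρm : ℝ) (hε : 0 < ε) (hε2 : ε < π/2)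
    (hη0 : 0 < η) (hη : η < min (π/4) (ε/2))
    (hμp : 0 < μp) (hμm : 0 < μm) (hρp : 0 < ρp) (hρm : 0 < ρm) :
    ∃ c > 0, ∀ (lam : ℂ), lam ≠ 0 → |lam.arg| < π - ε →
      ∀ ξ : Fin (n-1) → ℂ,
      (∀ j, ξ j ≠ 0 ∧ (|(ξ j).arg| < η ∨ π - η < |(ξ j).arg|)) →
      let A : ℂ := (∑ j, (ξ j)^2) ^ (1/2 : ℂ)
      let At : ℝ := Real.sqrt (∑ j, ‖ξ j‖^2)
      let Bp : ℂ := ((ρp * μp⁻¹ : ℝ) * lam + A^2) ^ (1/2 : ℂ)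
      let Bm : ℂ := ((ρm * μm⁻¹ : ℝ) * lam + A^2) ^ (1/2 : ℂ)
      let detL : ℂ := ((μp : ℂ) - μm)^2 * A^3
        - ((3 * (μp : ℂ) - μm) * μp * Bp + (3 * (μm : ℂ) - μp) * μm * Bm) * A^2
        - (((μp : ℂ) * Bp + μm * Bm)^2 + (μp : ℂ) * μm * (Bp + Bm)^2) * A
        - ((μp : ℂ) * Bp + μm * Bm) * ((μp : ℂ) * Bp^2 + μm * Bm^2)
      c * (Real.sqrt ‖lam‖ + At)^3 ≤ ‖detL‖ := by
  have hη4 : η < π/4 := lt_of_lt_of_le hη (min_le_left _ _)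
  have hηε : 2*η < ε := by have := lt_of_lt_of_le hη (min_le_right _ _); linarith
  set k := Real.cos (ε-2*η) with hk
  have hk0 : 0 ≤ k := Real.cos_nonneg_of_mem_Icc ⟨by linarith, by linarith⟩
  have hk1 : k < 1 := by
    rw [hk, ← Real.cos_zero]
    exact Real.cos_lt_cos_of_nonneg_of_le_pi le_rfl (by linarith) (by linarith)
  obtain ⟨c, hc, H⟩ := st_main μp μm ρp ρm k hμp hμm hρp hρm hk0 hk1
  set g := Real.cos (2*η) with hg
  have hgp : 0 < g := Real.cos_pos_of_mem_Ioo ⟨by linarith, by linarith⟩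
  have hg1 : g ≤ 1 := Real.cos_le_one _
  refine ⟨c*g^3, by positivity, ?_⟩
  intro lam hlam hlarg ξ hξ
  set S : ℂ := ∑ j, (ξ j)^2 with hS
  set R : ℝ := ∑ j, ‖ξ j‖^2 with hR
  have hRpos : 0 < R := by
    apply Finset.sum_pos
    · intro j _
      have := norm_pos_iff.2 (hξ j).1
      positivity
    · exact ⟨⟨0, by omega⟩, Finset.mem_univ _⟩
  have hSre : g*R ≤ S.re := by
    rw [hS, hR, Complex.re_sum, Finset.mul_sum]
    exact Finset.sum_le_sum fun j _ => (st_sq η hη0 hη4 (ξ j) (hξ j).2).1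
  have hSim : |S.im| ≤ Real.sin (2*η)*R := by
    rw [hS, hR, Complex.im_sum, Finset.mul_sum]
    exact (Finset.abs_sum_le_sum_abs _ _).trans
      (Finset.sum_le_sum fun j _ => (st_sq η hη0 hη4 (ξ j) (hξ j).2).2)
  have hSarg : |S.arg| ≤ 2*η := st_arg (2*η) (by linarith) (by linarith) S R hRpos hSre hSim
  obtain ⟨hz, z1, z2⟩ := st_z ε η hε2 hη0 hηε lam S hlarg hSarg
  intro A At Bp Bm detL
  have hA2 : A^2 = S := st_sqrt_sq S
  have hSrep : 0 < S.re := lt_of_lt_of_le (by positivity) hSre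
  have hAr : 0 < A.re := by
    have h0 : 0 ≤ A.re := st_sqrt_re S
    rcases h0.lt_or_eq with h | h
    · exact h
    · rw [← hA2] at hSrep
      simp [pow_two, ← h] at hSrep
      nlinarith [mul_self_nonneg A.im]
  have hA0 : A ≠ 0 := by intro h; simp [h] at hAr
  have hBp2 : Bp^2 = ((ρp * μp⁻¹ : ℝ):ℂ) * lam + S := by rw [← hA2]; exact st_sqrt_sq _
  have hBm2 : Bm^2 = ((ρm * μm⁻¹ : ℝ):ℂ) * lam + S := by rw [← hA2]; exact st_sqrt_sq _
  obtain ⟨x1, x2⟩ := st_root_re (ρp*μp⁻¹) k (by positivity) hk1 lam S A Bp hA2 hBp2 hAr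
    (st_sqrt_re _) hz z1 z2
  obtain ⟨y1, y2⟩ := st_root_re (ρm*μm⁻¹) k (by positivity) hk1 lam S A Bm hA2 hBm2 hAr
    (st_sqrt_re _) hz z1 z2
  have h := H (lam/S) (Bp/A) (Bm/A) x1 y1 x2 y2 hz
  set D := (μp*(Bp/A+1)+μm*(Bm/A+1))*(μp*(Bp/A*(Bp/A+1))+μm*(Bm/A*(Bm/A+1)))
        - (-(μp*(Bp/A-1))+μm*(Bm/A-1))^2 with hD
  have hdet : detL = -(A^3*D) := by
    simp only [detL, hD]
    field_simp
    ring
  rw [hdet, norm_neg, norm_mul, norm_pow]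
  have hAn : 0 < ‖A‖ := norm_pos_iff.2 hA0
  have hSn : ‖S‖ = ‖A‖^2 := by rw [← hA2, norm_pow]
  have hsq : √‖lam/S‖ = √‖lam‖/‖A‖ := by
    rw [norm_div, Real.sqrt_div (norm_nonneg _), hSn, Real.sqrt_sq hAn.le]
  have hAt : g*At ≤ ‖A‖ := by
    have hAt2 : At^2 = R := Real.sq_sqrt hRpos.le
    apply le_of_sq_le_sq _ hAn.le
    rw [← hSn, mul_pow, hAt2]
    have := Complex.re_le_norm S
    nlinarith [mul_pos hgp hRpos]
  have hAt0 : 0 ≤ At := Real.sqrt_nonneg _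
  calc c*g^3*(√‖lam‖+At)^3 = c*(g*√‖lam‖+g*At)^3 := by ring
    _ ≤ c*(√‖lam‖+‖A‖)^3 := by
        have : g*√‖lam‖ ≤ √‖lam‖ := mul_le_of_le_one_left (Real.sqrt_nonneg _) hg1
        gcongr
    _ = ‖A‖^3*(c*(1+√‖lam/S‖)^3) := by rw [hsq]; field_simp; ring
    _ ≤ _ := by gcongr
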